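/- Let $N_t \geq 2$ be an integer, $\rho > 0$ a real number, and $B_f, B_c \geq 0$ integers. Let $Z, A, S$ be nonnegative integrable random variables on a probability space such that: (i) $0 \le Z \le 1$ almost surely; (ii) $Z$ is independent of $A$ and $Z$ is independent of $S$; (iii) $\mathbb{E}[A] = \big(1 + (N_t-1)2^{B_f}\big)^{-1}$; (iv) $\mathbb{E}[S] = 1/(N_t - 1)$; (v) $\frac{N_t-1}{N_t}2^{-B_c/(N_t-1)} \le \mathbb{E}[Z] \le 2^{-B_c/(N_t-1)}$. Then $\rho N_t\,\mathbb{E}\big[(1-Z)A + ZS\big] \le \frac{\rho N_t}{N_t-1}\Big[2^{-B_f} + \Big(1 - \frac{N_t-1}{N_t}2^{-B_f}\Big)2^{-\frac{B_c}{N_t-1}}\Big]$. -/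

import Mathlib

open MeasureTheory ProbabilityTheory

/-- Theorem 2 of the paper (interference upper bound for two users):
if `𝔼[A] = (1+(N_t-1)2^{B_f})⁻¹`, `𝔼[S] = 1/(N_t-1)`,
`(N_t-1)/N_t · 2^{-B_c/(N_t-1)} ≤ 𝔼[Z] ≤ 2^{-B_c/(N_t-1)}`, `0 ≤ Z ≤ 1` a.s.,
`A, S ≥ 0` a.s., and `Z` is independent of `A` and of `S`, then
`ρ N_t 𝔼[(1-Z)A + ZS] ≤ ρN_t/(N_t-1)·[2^{-B_f} + (1-(N_t-1)/N_t·2^{-B_f})2^{-B_c/(N_t-1)}]`. -/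
theorem stmt_3
    {Ω : Type*} [MeasurableSpace Ω] (μ : Measure Ω) [IsProbabilityMeasure μ]
    (Nt Bf Bc : ℕ) (hNt : 2 ≤ Nt) (ρ : ℝ) (hρ : 0 < ρ)
    (Z A S : Ω → ℝ)
    (hZmeas : Measurable Z) (hAmeas : Measurable A) (hSmeas : Measurable S)
    (hZint : Integrable Z μ) (hAint : Integrable A μ) (hSint : Integrable S μ)
    (hZ01 : ∀ᵐ ω ∂μ, Z ω ∈ Set.Icc (0 : ℝ) 1)
    (hA0 : ∀ᵐ ω ∂μ, 0 ≤ A ω) (hS0 : ∀ᵐ ω ∂μ, 0 ≤ S ω)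
    (hZA : IndepFun Z A μ) (hZS : IndepFun Z S μ)
    (hEA : ∫ ω, A ω ∂μ = (1 + ((Nt : ℝ) - 1) * (2 : ℝ) ^ (Bf : ℝ))⁻¹)
    (hES : ∫ ω, S ω ∂μ = 1 / ((Nt : ℝ) - 1))
    (hEZlow : ((Nt : ℝ) - 1) / Nt * (2 : ℝ) ^ (-(Bc : ℝ) / ((Nt : ℝ) - 1)) ≤ ∫ ω, Z ω ∂μ)
    (hEZhigh : ∫ ω, Z ω ∂μ ≤ (2 : ℝ) ^ (-(Bc : ℝ) / ((Nt : ℝ) - 1))) :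
    ρ * Nt * ∫ ω, ((1 - Z ω) * A ω + Z ω * S ω) ∂μ
      ≤ ρ * Nt / ((Nt : ℝ) - 1)
        * ((2 : ℝ) ^ (-(Bf : ℝ))
          + (1 - ((Nt : ℝ) - 1) / Nt * (2 : ℝ) ^ (-(Bf : ℝ)))
            * (2 : ℝ) ^ (-(Bc : ℝ) / ((Nt : ℝ) - 1))) := by
  have hn : (0 : ℝ) < (Nt : ℝ) - 1 := by
    have : (2 : ℝ) ≤ Nt := by exact_mod_cast hNt
    linarith
  have hZAint : Integrable (fun ω => Z ω * A ω) μ := hZA.integrable_mul hZint hAint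
  have hZSint : Integrable (fun ω => Z ω * S ω) μ := hZS.integrable_mul hZint hSint
  have hZA_eq : ∫ ω, Z ω * A ω ∂μ = (∫ ω, Z ω ∂μ) * ∫ ω, A ω ∂μ :=
    hZA.integral_fun_mul_eq_mul_integral hZmeas.aestronglyMeasurable hAmeas.aestronglyMeasurable
  have hZS_eq : ∫ ω, Z ω * S ω ∂μ = (∫ ω, Z ω ∂μ) * ∫ ω, S ω ∂μ :=
    hZS.integral_fun_mul_eq_mul_integral hZmeas.aestronglyMeasurable hSmeas.aestronglyMeasurable
  have hmean : ∫ ω, ((1 - Z ω) * A ω + Z ω * S ω) ∂μ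
      = (1 - ∫ ω, Z ω ∂μ) * (∫ ω, A ω ∂μ) + (∫ ω, Z ω ∂μ) * ∫ ω, S ω ∂μ := by
    simp only [sub_mul, one_mul]
    rw [integral_add (f := fun ω => A ω - Z ω * A ω) (hAint.sub hZAint) hZSint,
      integral_sub hAint hZAint, hZA_eq, hZS_eq]
  have hZ1 : ∫ ω, Z ω ∂μ ≤ 1 := by
    have h := integral_mono_ae hZint (integrable_const (1 : ℝ)) (hZ01.mono fun ω h => h.2)
    simpa using h
  rw [hmean, hES]
  have hf : (0 : ℝ) < (2 : ℝ) ^ (-(Bf : ℝ)) := by positivity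
  have hA_le : ((Nt : ℝ) - 1) * ∫ ω, A ω ∂μ ≤ (2 : ℝ) ^ (-(Bf : ℝ)) := by
    have hp : (0 : ℝ) < (2 : ℝ) ^ (Bf : ℝ) := by positivity
    rw [hEA, Real.rpow_neg zero_le_two, ← div_eq_mul_inv, div_le_iff₀ (by positivity),
      mul_add, mul_left_comm, inv_mul_cancel₀ hp.ne']
    linarith [inv_pos.mpr hp]
  generalize (2 : ℝ) ^ (-(Bf : ℝ)) = f at *
  generalize (2 : ℝ) ^ (-(Bc : ℝ) / ((Nt : ℝ) - 1)) = d at *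
  generalize ∫ ω, Z ω ∂μ = z at *
  generalize ∫ ω, A ω ∂μ = a at *
  have hbound : (1 - z) * (((Nt : ℝ) - 1) * a) + z
      ≤ f + (1 - ((Nt : ℝ) - 1) / Nt * f) * d := by
    have h₁ := mul_le_mul_of_nonneg_left hA_le (sub_nonneg.mpr hZ1)
    have h₂ := mul_le_mul_of_nonneg_right hEZlow hf.le
    linarith
  calc ρ * Nt * ((1 - z) * a + z * (1 / ((Nt : ℝ) - 1)))
      = ρ * Nt / ((Nt : ℝ) - 1) * ((1 - z) * (((Nt : ℝ) - 1) * a) + z) := by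
        field_simp
    _ ≤ _ := by gcongr
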